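/- For all integers 1 ≤ m < k < n, the probability Q_k(m,n,+) that the (1,2) random walk Y started at Y₀ = k hits the set [n,∞) before it hits [0,m] equals (Σ_{s=m+1}^{k} e₁ A_s A_{s+1}⋯A_{n−1} e₁ᵗ) / (1 + Σ_{s=m+1}^{n−1} e₁ A_s A_{s+1}⋯A_{n−1} e₁ᵗ), where an empty matrix product (when s = n) is the identity matrix. -/

import Mathlib

open Filter MeasureTheory ENNReal Topology

noncomputable section

/-- Transition function of the (1,2) random walk `Y`. -/
def transY (q p1 p2 : ℕ → ℝ) (n j : ℕ) : ℝ :=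
  if n = 0 then (if j = 2 then 1 else 0)
  else if n = 1 then (if j = 0 then 1 else 0)
  else if j = n - 1 then q n
  else if j = n + 1 then p1 n
  else if j = n + 2 then p2 n
  else 0

/-- `μ` is the law (on path space) of the time-homogeneous Markov chain on `ℕ`
with one-step transition probabilities `p` and initial state `init`. -/
def IsMarkovChain (μ : Measure (ℕ → ℕ)) (p : ℕ → ℕ → ℝ) (init : ℕ) : Prop :=
  μ {ω | ω 0 = init} = 1 ∧
  ∀ (k : ℕ) (x : ℕ → ℕ) (j : ℕ),
    μ {ω | (∀ i ≤ k, ω i = x i) ∧ ω (k + 1) = j}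
      = ENNReal.ofReal (p (x k) j) * μ {ω | ∀ i ≤ k, ω i = x i}

/-- The matrix `A_k` with first row `(a_k, b_k)` and second row `(1, 0)`. -/
def Amat (q p1 p2 : ℕ → ℝ) (k : ℕ) : Matrix (Fin 2) (Fin 2) ℝ :=
  !![(p1 k + p2 k) / q k, p2 k / q k; 1, 0]

/-- The ordered product `A_s A_{s+1} ⋯ A_{n-1}` (identity when `s ≥ n`). -/
def prodAsc (q p1 p2 : ℕ → ℝ) (s n : ℕ) : Matrix (Fin 2) (Fin 2) ℝ :=
  ((List.range (n - s)).map fun i => Amat q p1 p2 (s + i)).prod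

lemma prodAsc_self (q p1 p2 : ℕ → ℝ) (n : ℕ) : prodAsc q p1 p2 n n = 1 := by
  simp [prodAsc]

lemma prodAsc_step (q p1 p2 : ℕ → ℝ) {s n : ℕ} (h : s < n) :
    prodAsc q p1 p2 s n = Amat q p1 p2 s * prodAsc q p1 p2 (s + 1) n := by
  obtain ⟨d, rfl⟩ := Nat.exists_eq_add_of_lt h
  have e1 : s + d + 1 - s = d + 1 := by omega
  have e2 : s + d + 1 - (s + 1) = d := by omega
  simp only [prodAsc, e1, e2]
  rw [List.range_succ_eq_map]
  simp only [List.map_cons, List.prod_cons, List.map_map, add_zero]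
  congr 3
  funext i
  simp only [Function.comp]
  congr 1
  omega

lemma prodAsc_00 (q p1 p2 : ℕ → ℝ) {s n : ℕ} (h : s < n) :
    prodAsc q p1 p2 s n 0 0 = (p1 s + p2 s) / q s * prodAsc q p1 p2 (s + 1) n 0 0
      + p2 s / q s * prodAsc q p1 p2 (s + 1) n 1 0 := by
  rw [prodAsc_step q p1 p2 h]
  simp [Amat, Matrix.mul_apply, Fin.sum_univ_two]

lemma prodAsc_10 (q p1 p2 : ℕ → ℝ) {s n : ℕ} (h : s < n) :
    prodAsc q p1 p2 s n 1 0 = prodAsc q p1 p2 (s + 1) n 0 0 := by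
  rw [prodAsc_step q p1 p2 h]
  simp [Amat, Matrix.mul_apply, Fin.sum_univ_two]

lemma prodAsc_nonneg (q p1 p2 : ℕ → ℝ)
    (hq : ∀ k, 2 ≤ k → 0 < q k) (hp1 : ∀ k, 2 ≤ k → 0 ≤ p1 k)
    (hp2 : ∀ k, 2 ≤ k → 0 < p2 k) (n d : ℕ) :
    ∀ s, 2 ≤ s → s + d = n →
      0 ≤ prodAsc q p1 p2 s n 0 0 ∧ 0 ≤ prodAsc q p1 p2 s n 1 0 := by
  induction d with
  | zero =>
    intro s hs h
    obtain rfl : s = n := by omega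
    simp [prodAsc_self]
  | succ d ih =>
    intro s hs h
    obtain ⟨h0, h1⟩ := ih (s + 1) (by omega) (by omega)
    rw [prodAsc_00 q p1 p2 (by omega : s < n), prodAsc_10 q p1 p2 (by omega : s < n)]
    have := hq s hs
    have := hp1 s hs
    have := hp2 s hs
    exact ⟨by positivity, h0⟩

/-- Increments of the (unnormalised) harmonic function. -/
def dinc (q p1 p2 : ℕ → ℝ) (n s : ℕ) : ℝ := if s ≤ n then prodAsc q p1 p2 s n 0 0 else 0

/-- The (unnormalised) harmonic function. -/
def Fh (q p1 p2 : ℕ → ℝ) (m n y : ℕ) : ℝ := ∑ s ∈ Finset.Icc (m + 1) y, dinc q p1 p2 n s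

lemma Fh_succ (q p1 p2 : ℕ → ℝ) {m n y : ℕ} (h : m ≤ y) :
    Fh q p1 p2 m n (y + 1) = Fh q p1 p2 m n y + dinc q p1 p2 n (y + 1) := by
  unfold Fh
  rw [Finset.sum_Icc_succ_top (by omega)]

lemma Fh_low (q p1 p2 : ℕ → ℝ) {m n y : ℕ} (h : y ≤ m) : Fh q p1 p2 m n y = 0 := by
  unfold Fh
  rw [Finset.Icc_eq_empty (by omega)]
  simp

lemma dinc_rec (q p1 p2 : ℕ → ℝ) (hq : ∀ k, 2 ≤ k → 0 < q k) {x n : ℕ} (hx : 2 ≤ x)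
    (h : x < n) : q x * dinc q p1 p2 n x
      = (p1 x + p2 x) * dinc q p1 p2 n (x + 1) + p2 x * dinc q p1 p2 n (x + 2) := by
  have hq' := (hq x hx).ne'
  have e : prodAsc q p1 p2 (x + 1) n 1 0 = dinc q p1 p2 n (x + 2) := by
    unfold dinc
    split_ifs with h2
    · rw [prodAsc_10 q p1 p2 (by omega)]
    · obtain rfl : n = x + 1 := by omega
      simp [prodAsc_self]
  rw [← e]
  unfold dinc
  rw [if_pos (by omega), if_pos (by omega), prodAsc_00 q p1 p2 h]
  field_simp

lemma transY_eq (q p1 p2 : ℕ → ℝ) {x : ℕ} (hx : 2 ≤ x) (y : ℕ) :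
    transY q p1 p2 x y = (if y = x - 1 then q x else 0) + (if y = x + 1 then p1 x else 0)
      + (if y = x + 2 then p2 x else 0) := by
  unfold transY
  rw [if_neg (by omega), if_neg (by omega)]
  split_ifs <;> first | omega | simp

lemma Fh_harm (q p1 p2 : ℕ → ℝ) (hq : ∀ k, 2 ≤ k → 0 < q k)
    (hsum : ∀ k, 2 ≤ k → q k + p1 k + p2 k = 1) {m n x : ℕ} (hm : 1 ≤ m) (hx : m < x)
    (hn : x < n) :
    ∑ y ∈ Finset.range (n + 2), transY q p1 p2 x y * Fh q p1 p2 m n y = Fh q p1 p2 m n x := by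
  have h2 : 2 ≤ x := by omega
  simp only [transY_eq q p1 p2 h2, add_mul, ite_mul, zero_mul, Finset.sum_add_distrib,
    Finset.sum_ite_eq', Finset.mem_range]
  rw [if_pos (by omega), if_pos (by omega), if_pos (by omega)]
  obtain ⟨z, rfl⟩ : ∃ z, x = z + 1 := ⟨x - 1, by omega⟩
  have hr := dinc_rec q p1 p2 hq h2 hn
  have hs := hsum _ h2
  rw [show z + 1 - 1 = z by omega, show z + 1 + 2 = z + 1 + 1 + 1 by omega,
    Fh_succ q p1 p2 (by omega : m ≤ z + 1 + 1), Fh_succ q p1 p2 (by omega : m ≤ z + 1),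
    Fh_succ q p1 p2 (by omega : m ≤ z)]
  rw [show z + 1 + 2 = z + 1 + 1 + 1 by omega] at hr
  have hq1 : q (z + 1) = 1 - p1 (z + 1) - p2 (z + 1) := by linarith
  rw [hq1] at hr ⊢
  linear_combination -hr

lemma transY_nonneg (q p1 p2 : ℕ → ℝ)
    (hq : ∀ k, 2 ≤ k → 0 < q k) (hp1 : ∀ k, 2 ≤ k → 0 ≤ p1 k)
    (hp2 : ∀ k, 2 ≤ k → 0 < p2 k) {x : ℕ} (hx : 2 ≤ x) (y : ℕ) : 0 ≤ transY q p1 p2 x y := by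
  rw [transY_eq q p1 p2 hx]
  have := hq x hx
  have := hp1 x hx
  have := hp2 x hx
  split_ifs <;> positivity

/-- Paths which stay in `(m, n)` before time `t` and are at `y` at time `t`. -/
def Sset (m n t y : ℕ) : Set (ℕ → ℕ) := {ω | ω t = y ∧ ∀ i < t, m < ω i ∧ ω i < n}

/-- Paths which enter `[n, ∞)` at time `t`, staying in `(m, n)` before. -/
def Eset (m n t : ℕ) : Set (ℕ → ℕ) := {ω | n ≤ ω t ∧ ∀ i < t, m < ω i ∧ ω i < n}

lemma meas_before (m n t : ℕ) :
    MeasurableSet {ω : ℕ → ℕ | ∀ i < t, m < ω i ∧ ω i < n} := by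
  have : {ω : ℕ → ℕ | ∀ i < t, m < ω i ∧ ω i < n}
      = ⋂ i, ⋂ (_ : i < t), (fun ω : ℕ → ℕ => ω i) ⁻¹' (Set.Ioo m n) := by
    ext ω; simp
  rw [this]
  exact MeasurableSet.iInter fun i => MeasurableSet.iInter fun _ =>
    (measurable_pi_apply i) (MeasurableSet.of_discrete)

lemma meas_eq (t y : ℕ) : MeasurableSet {ω : ℕ → ℕ | ω t = y} := by
  have : {ω : ℕ → ℕ | ω t = y} = (fun ω : ℕ → ℕ => ω t) ⁻¹' {y} := by
    ext ω; simp
  rw [this]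
  exact (measurable_pi_apply t) (MeasurableSet.of_discrete)

lemma meas_Sset (m n t y : ℕ) : MeasurableSet (Sset m n t y) :=
  (meas_eq t y).inter (meas_before m n t)

lemma meas_Eset (m n t : ℕ) : MeasurableSet (Eset m n t) :=
  ((measurable_pi_apply t) (MeasurableSet.of_discrete (s := Set.Ici n))).inter
    (meas_before m n t)

/-- Extension of a finite history. -/
def extv {t : ℕ} (v : Fin (t + 1) → ℕ) (i : ℕ) : ℕ := if h : i < t + 1 then v ⟨i, h⟩ else 0

lemma meas_cyl (t : ℕ) (x : ℕ → ℕ) : MeasurableSet {ω : ℕ → ℕ | ∀ i ≤ t, ω i = x i} := by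
  have : {ω : ℕ → ℕ | ∀ i ≤ t, ω i = x i}
      = ⋂ i, ⋂ (_ : i ≤ t), (fun ω : ℕ → ℕ => ω i) ⁻¹' {x i} := by
    ext ω; simp
  rw [this]
  exact MeasurableSet.iInter fun i => MeasurableSet.iInter fun _ =>
    (measurable_pi_apply i) (MeasurableSet.of_discrete)

lemma extv_iff {t : ℕ} (v : Fin (t + 1) → ℕ) (ω : ℕ → ℕ) :
    (∀ i ≤ t, ω i = extv v i) ↔ v = fun i : Fin (t + 1) => ω i := by
  constructor
  · intro h
    funext i
    have := h i (by omega)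
    rw [this]
    simp only [extv, dif_pos i.2]
  · rintro rfl i hi
    simp [extv, Nat.lt_succ_of_le hi]

lemma a_step (ν : Measure (ℕ → ℕ)) [IsProbabilityMeasure ν] (p : ℕ → ℕ → ℝ) (k : ℕ)
    (hν : IsMarkovChain ν p k) (m n : ℕ) (hp : ∀ x ∈ Finset.Ioo m n, ∀ y, 0 ≤ p x y) (t y : ℕ) :
    ν.real (Sset m n (t + 1) y) = ∑ x ∈ Finset.Ioo m n, ν.real (Sset m n t x) * p x y := by
  classical
  set V := Fintype.piFinset (fun _ : Fin (t + 1) => Finset.Ioo m n) with hV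
  have h1 : Sset m n (t + 1) y
      = ⋃ v ∈ V, {ω | (∀ i ≤ t, ω i = extv v i) ∧ ω (t + 1) = y} := by
    ext ω
    simp only [Sset, Set.mem_ofPred_eq, Set.mem_iUnion, extv_iff, exists_prop]
    constructor
    · rintro ⟨ha, hb⟩
      refine ⟨_, ?_, rfl, ha⟩
      rw [hV, Fintype.mem_piFinset]
      intro i
      exact Finset.mem_Ioo.2 (hb i i.2)
    · rintro ⟨v, hv, rfl, ha⟩
      refine ⟨ha, fun i hi => ?_⟩
      rw [hV, Fintype.mem_piFinset] at hv
      exact Finset.mem_Ioo.1 (hv ⟨i, hi⟩)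
  have h2 : ∀ x ∈ Finset.Ioo m n, Sset m n t x
      = ⋃ v ∈ V.filter (fun v => v (Fin.last t) = x), {ω | ∀ i ≤ t, ω i = extv v i} := by
    intro x hx
    ext ω
    simp only [Sset, Set.mem_ofPred_eq, Set.mem_iUnion, extv_iff, exists_prop, Finset.mem_filter]
    constructor
    · rintro ⟨ha, hb⟩
      refine ⟨_, ⟨?_, ?_⟩, rfl⟩
      · rw [hV, Fintype.mem_piFinset]
        intro i
        rcases Nat.lt_or_ge i t with h | h
        · exact Finset.mem_Ioo.2 (hb i h)
        · have : (i : ℕ) = t := by omega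
          simp only [this, ha]
          exact hx
      · simpa using ha
    · rintro ⟨v, ⟨hv, hl⟩, rfl⟩
      refine ⟨by simpa using hl, fun i hi => ?_⟩
      rw [hV, Fintype.mem_piFinset] at hv
      exact Finset.mem_Ioo.1 (hv ⟨i, by omega⟩)
  have hdis : ∀ v w : Fin (t + 1) → ℕ, v ≠ w →
      Disjoint {ω : ℕ → ℕ | ∀ i ≤ t, ω i = extv v i} {ω | ∀ i ≤ t, ω i = extv w i} := by
    intro v w hvw
    rw [Set.disjoint_left]
    intro ω ha hb
    simp only [Set.mem_ofPred_eq, extv_iff] at ha hb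
    exact hvw (ha.trans hb.symm)
  have hstep : ∀ v ∈ V, ν.real {ω | (∀ i ≤ t, ω i = extv v i) ∧ ω (t + 1) = y}
      = ν.real {ω | ∀ i ≤ t, ω i = extv v i} * p (v (Fin.last t)) y := by
    intro v hv
    have hl : extv v t = v (Fin.last t) := by simp [extv, Fin.last]
    have hpos := hp (v (Fin.last t)) (by rw [hV, Fintype.mem_piFinset] at hv; exact hv _) y
    rw [Measure.real, hν.2 t (extv v) y, ENNReal.toReal_mul, hl, ENNReal.toReal_ofReal hpos,
      mul_comm, Measure.real]
  rw [h1, measureReal_biUnion_finset]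
  · rw [Finset.sum_congr rfl hstep]
    rw [← Finset.sum_fiberwise_of_maps_to (t := Finset.Ioo m n) (g := fun v => v (Fin.last t))]
    · refine Finset.sum_congr rfl fun x hx => ?_
      rw [h2 x hx, measureReal_biUnion_finset, Finset.sum_mul]
      · refine Finset.sum_congr rfl fun v hv => ?_
        rw [(Finset.mem_filter.1 hv).2]
      · intro v _ w _ hvw
        exact hdis v w hvw
      · intro v _
        exact meas_cyl t _
    · intro v hv
      rw [hV, Fintype.mem_piFinset] at hv
      exact hv _
  · intro v _ w _ hvw
    exact (hdis v w hvw).mono (fun ω h => h.1) (fun ω h => h.1)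
  · intro v _
    exact (meas_cyl t _).inter
      (meas_eq (t + 1) y)

lemma hasSum_real (ν : Measure (ℕ → ℕ)) [IsProbabilityMeasure ν] (S : ℕ → Set (ℕ → ℕ))
    (hm : ∀ t, MeasurableSet (S t)) (hd : Pairwise (Function.onFun Disjoint S)) :
    HasSum (fun t => ν.real (S t)) (ν.real (⋃ t, S t)) := by
  have h := measure_iUnion (μ := ν) hd hm
  have hne : ∑' t, ν (S t) ≠ ∞ := by rw [← h]; exact measure_ne_top _ _
  have hne' : ∀ t, ν (S t) ≠ ∞ := fun t => measure_ne_top _ _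
  simp only [Measure.real, h]
  rw [ENNReal.tsum_toReal_eq hne']
  exact ENNReal.hasSum_toReal hne

lemma exit_disj (m n : ℕ) (S : ℕ → Set (ℕ → ℕ))
    (h1 : ∀ t, ∀ ω ∈ S t, ¬ (m < ω t ∧ ω t < n))
    (h2 : ∀ t, ∀ ω ∈ S t, ∀ i < t, m < ω i ∧ ω i < n) :
    Pairwise (Function.onFun Disjoint S) := by
  intro s t hst
  simp only [Function.onFun]
  rw [Set.disjoint_left]
  intro ω ha hb
  rcases lt_or_gt_of_ne hst with h | h
  · exact h1 s ω ha (h2 t ω hb s h)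
  · exact h1 t ω hb (h2 s ω ha t h)

lemma a_zero (q p1 p2 : ℕ → ℝ)
    (hq : ∀ k, 2 ≤ k → 0 < q k) (hp1 : ∀ k, 2 ≤ k → 0 ≤ p1 k)
    (hp2 : ∀ k, 2 ≤ k → 0 < p2 k)
    (ν : Measure (ℕ → ℕ)) [IsProbabilityMeasure ν] (k : ℕ)
    (hν : IsMarkovChain ν (transY q p1 p2) k) (m n : ℕ) (hm : 1 ≤ m) (d : ℕ) (hd : m + d < n) :
    Tendsto (fun t => ν.real (Sset m n t (m + d))) atTop (𝓝 0) := by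
  induction d with
  | zero =>
    refine (hasSum_real ν (fun t => Sset m n t (m + 0)) (fun t => meas_Sset _ _ _ _)
      (exit_disj m n _ ?_ ?_)).summable.tendsto_atTop_zero
    · rintro t ω ⟨h, _⟩ ⟨h', _⟩
      omega
    · rintro t ω ⟨_, h⟩
      exact h
  | succ d ih =>
    have h1 := (ih (by omega)).comp (tendsto_add_atTop_nat 1)
    have hqp := hq (m + (d + 1)) (by omega)
    have h2 := h1.div_const (q (m + (d + 1)))
    rw [zero_div] at h2
    refine squeeze_zero (fun t => measureReal_nonneg) (fun t => ?_) h2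
    rw [le_div_iff₀ hqp]
    simp only [Function.comp]
    have hp : ∀ x ∈ Finset.Ioo m n, ∀ y, 0 ≤ transY q p1 p2 x y := fun x hx y =>
      transY_nonneg q p1 p2 hq hp1 hp2 (by rw [Finset.mem_Ioo] at hx; omega) y
    rw [a_step ν _ k hν m n hp t (m + d)]
    have := Finset.single_le_sum
      (f := fun x => ν.real (Sset m n t x) * transY q p1 p2 x (m + d))
      (fun x hx => mul_nonneg measureReal_nonneg (hp x hx _))
      (Finset.mem_Ioo.2 ⟨by omega, hd⟩ : m + (d + 1) ∈ Finset.Ioo m n)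
    refine le_trans (le_of_eq ?_) this
    congr 1
    rw [transY_eq q p1 p2 (by omega), if_pos (by omega), if_neg (by omega), if_neg (by omega)]
    simp

lemma e_step (q p1 p2 : ℕ → ℝ)
    (hq : ∀ k, 2 ≤ k → 0 < q k) (hp1 : ∀ k, 2 ≤ k → 0 ≤ p1 k)
    (hp2 : ∀ k, 2 ≤ k → 0 < p2 k)
    (ν : Measure (ℕ → ℕ)) [IsProbabilityMeasure ν] (k : ℕ)
    (hν : IsMarkovChain ν (transY q p1 p2) k) (m n : ℕ) (hm : 1 ≤ m) (t : ℕ) :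
    ν.real (Eset m n (t + 1))
      = ν.real (Sset m n (t + 1) n) + ν.real (Sset m n (t + 1) (n + 1)) := by
  have hp : ∀ x ∈ Finset.Ioo m n, ∀ y, 0 ≤ transY q p1 p2 x y := fun x hx y =>
      transY_nonneg q p1 p2 hq hp1 hp2 (by rw [Finset.mem_Ioo] at hx; omega) y
  have hnull : ν (⋃ j, Sset m n (t + 1) (n + 2 + j)) = 0 := by
    rw [measure_iUnion_null_iff]
    intro j
    rw [← measureReal_eq_zero_iff, a_step ν _ k hν m n hp]
    refine Finset.sum_eq_zero fun x hx => ?_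
    rw [Finset.mem_Ioo] at hx
    rw [transY_eq q p1 p2 (by omega), if_neg (by omega), if_neg (by omega), if_neg (by omega)]
    simp
  have hU : Eset m n (t + 1) = (Sset m n (t + 1) n ∪ Sset m n (t + 1) (n + 1))
      ∪ ⋃ j, Sset m n (t + 1) (n + 2 + j) := by
    ext ω
    simp only [Eset, Sset, Set.mem_union, Set.mem_iUnion, Set.mem_ofPred_eq]
    constructor
    · rintro ⟨h, h'⟩
      rcases Nat.lt_or_ge (ω (t + 1)) (n + 2) with hc | hc
      · left
        rcases Nat.lt_or_ge (ω (t + 1)) (n + 1) with hc' | hc'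
        · exact Or.inl ⟨by omega, h'⟩
        · exact Or.inr ⟨by omega, h'⟩
      · exact Or.inr ⟨ω (t + 1) - (n + 2), by omega, h'⟩
    · rintro ((⟨h, h'⟩ | ⟨h, h'⟩) | ⟨j, h, h'⟩) <;> exact ⟨by omega, h'⟩
  have e1 : ν (Eset m n (t + 1)) = ν (Sset m n (t + 1) n ∪ Sset m n (t + 1) (n + 1)) := by
    rw [hU]
    refine le_antisymm ((measure_union_le _ _).trans ?_) (measure_mono Set.subset_union_left)
    rw [hnull, add_zero]
  rw [Measure.real, e1, ← Measure.real, measureReal_union _ (meas_Sset _ _ _ _)]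
  rw [Set.disjoint_left]
  rintro ω ⟨h, _⟩ ⟨h', _⟩
  omega

theorem escape_probability_Y
    (q p1 p2 : ℕ → ℝ)
    (hq : ∀ k, 2 ≤ k → 0 < q k) (hp1 : ∀ k, 2 ≤ k → 0 ≤ p1 k)
    (hp2 : ∀ k, 2 ≤ k → 0 < p2 k)
    (hsum : ∀ k, 2 ≤ k → q k + p1 k + p2 k = 1)
    (μ : ℕ → Measure (ℕ → ℕ)) (hprob : ∀ x, IsProbabilityMeasure (μ x))
    (hμ : ∀ x, IsMarkovChain (μ x) (transY q p1 p2) x) :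
    ∀ m k n : ℕ, 1 ≤ m → m < k → k < n →
      ((μ k) {ω | ∃ t, n ≤ ω t ∧ ∀ i < t, m < ω i ∧ ω i < n}).toReal
        = (∑ s ∈ Finset.Icc (m + 1) k, prodAsc q p1 p2 s n 0 0)
          / (1 + ∑ s ∈ Finset.Icc (m + 1) (n - 1), prodAsc q p1 p2 s n 0 0) := by
  intro m k n hm hmk hkn
  have := hprob k
  have hν := hμ k
  set ν := μ k with hνdef
  have hp : ∀ x ∈ Finset.Ioo m n, ∀ y, 0 ≤ transY q p1 p2 x y := fun x hx y =>
      transY_nonneg q p1 p2 hq hp1 hp2 (by rw [Finset.mem_Ioo] at hx; omega) y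
  set F := Fh q p1 p2 m n with hF
  have hnum : ∑ s ∈ Finset.Icc (m + 1) k, prodAsc q p1 p2 s n 0 0 = F k := by
    refine Finset.sum_congr rfl fun s hs => ?_
    rw [Finset.mem_Icc] at hs
    rw [dinc, if_pos (by omega)]
  have hden : 1 + ∑ s ∈ Finset.Icc (m + 1) (n - 1), prodAsc q p1 p2 s n 0 0 = F n := by
    have h1 : F n = F (n - 1) + dinc q p1 p2 n n := by
      have := Fh_succ q p1 p2 (m := m) (n := n) (y := n - 1) (by omega)
      rwa [show n - 1 + 1 = n by omega] at this
    have h2 : dinc q p1 p2 n n = 1 := by simp [dinc, prodAsc_self]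
    rw [h1, h2, add_comm]
    congr 1
    refine Finset.sum_congr rfl fun s hs => ?_
    rw [Finset.mem_Icc] at hs
    rw [dinc, if_pos (by omega)]
  have hFn1 : F (n + 1) = F n := by
    rw [hF, Fh_succ q p1 p2 (by omega)]
    simp [dinc]
  have hpos : 0 < F n := by
    rw [← hden]
    have : 0 ≤ ∑ s ∈ Finset.Icc (m + 1) (n - 1), prodAsc q p1 p2 s n 0 0 := by
      refine Finset.sum_nonneg fun s hs => ?_
      rw [Finset.mem_Icc] at hs
      exact (prodAsc_nonneg q p1 p2 hq hp1 hp2 n (n - s) s (by omega) (by omega)).1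
    linarith
  rw [hnum, hden]
  have hnull0 : ν {ω | ω 0 ≠ k} = 0 := by
    have hms : MeasurableSet {ω : ℕ → ℕ | ω 0 = k} :=
      meas_eq 0 k
    exact (prob_compl_eq_zero_iff hms).2 hν.1
  have ha0 : ∀ x, ν.real (Sset m n 0 x) = if x = k then 1 else 0 := by
    intro x
    split_ifs with h
    · subst h
      have : Sset m n 0 x = {ω | ω 0 = x} := by ext ω; simp [Sset]
      rw [this, Measure.real, hν.1]
      simp
    · rw [measureReal_eq_zero_iff]
      refine measure_mono_null ?_ hnull0
      rintro ω ⟨h', _⟩ h2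
      exact h (h'.symm.trans h2)
  have he0 : ν.real (Eset m n 0) = 0 := by
    rw [measureReal_eq_zero_iff]
    refine measure_mono_null ?_ hnull0
    rintro ω ⟨h', _⟩ (h2 : ω 0 = k)
    omega
  have key : ∀ t, ∑ s ∈ Finset.range (t + 1), ν.real (Eset m n s) * F n
      + ∑ x ∈ Finset.Ioo m n, ν.real (Sset m n t x) * F x = F k := by
    intro t
    induction t with
    | zero =>
      simp only [zero_add, Finset.range_one, Finset.sum_singleton, he0, ha0, ite_mul, one_mul,
        zero_mul, Finset.sum_ite_eq', Finset.mem_Ioo]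
      rw [if_pos ⟨hmk, hkn⟩]
    | succ t ih =>
      have h1 : ∑ x ∈ Finset.Ioo m n, ν.real (Sset m n t x) * F x
          = ∑ y ∈ Finset.range (n + 2), ν.real (Sset m n (t + 1) y) * F y := by
        have : ∀ x ∈ Finset.Ioo m n, ν.real (Sset m n t x) * F x
            = ∑ y ∈ Finset.range (n + 2), ν.real (Sset m n t x) * transY q p1 p2 x y * F y := by
          intro x hx
          rw [Finset.mem_Ioo] at hx
          rw [hF, ← Fh_harm q p1 p2 hq hsum hm hx.1 hx.2, Finset.mul_sum]
          simp only [mul_assoc]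
        rw [Finset.sum_congr rfl this, Finset.sum_comm]
        refine Finset.sum_congr rfl fun y _ => ?_
        rw [a_step ν _ k hν m n hp, Finset.sum_mul]
      have h2 : ∑ y ∈ Finset.range n, ν.real (Sset m n (t + 1) y) * F y
          = ∑ x ∈ Finset.Ioo m n, ν.real (Sset m n (t + 1) x) * F x := by
        symm
        refine Finset.sum_subset ?_ ?_
        · intro x hx
          rw [Finset.mem_Ioo] at hx
          exact Finset.mem_range.2 hx.2
        · intro x hx hx'
          rw [Finset.mem_range] at hx
          rw [Finset.mem_Ioo] at hx'
          rw [hF, Fh_low q p1 p2 (by omega), mul_zero]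
      rw [Finset.sum_range_succ, Finset.sum_range_succ, h2, hFn1] at h1
      rw [Finset.sum_range_succ, e_step q p1 p2 hq hp1 hp2 ν k hν m n hm]
      rw [h1] at ih
      linarith
  have hI : Tendsto (fun t => ∑ x ∈ Finset.Ioo m n, ν.real (Sset m n t x) * F x) atTop (𝓝 0) := by
    have : Tendsto (fun t => ∑ x ∈ Finset.Ioo m n, ν.real (Sset m n t x) * F x) atTop
        (𝓝 (∑ x ∈ Finset.Ioo m n, 0 * F x)) := by
      refine tendsto_finsetSum _ fun x hx => ?_
      rw [Finset.mem_Ioo] at hx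
      have := a_zero q p1 p2 hq hp1 hp2 ν k hν m n hm (x - m) (by omega)
      rw [show m + (x - m) = x by omega] at this
      exact this.mul_const _
    simpa using this
  have hE := (hasSum_real ν (Eset m n) (meas_Eset m n) (exit_disj m n _
    (by rintro t ω ⟨h, _⟩ ⟨_, h'⟩; omega) (by rintro t ω ⟨_, h⟩; exact h))).mul_right (F n)
  have hE1 := hE.tendsto_sum_nat.comp (tendsto_add_atTop_nat 1)
  have hE2 := hE1.add hI
  have hE3 : Tendsto (fun _ : ℕ => F k) atTop (𝓝 (ν.real (⋃ t, Eset m n t) * F n + 0)) := by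
    refine hE2.congr fun t => ?_
    exact key t
  have hfin := tendsto_nhds_unique hE3 tendsto_const_nhds
  have hset : {ω : ℕ → ℕ | ∃ t, n ≤ ω t ∧ ∀ i < t, m < ω i ∧ ω i < n} = ⋃ t, Eset m n t := by
    ext ω
    simp [Eset]
  rw [hset, eq_div_iff hpos.ne']
  rw [add_zero] at hfin
  exact hfin

end
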